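/- For every n ≥ 2, closed choice for nonempty subsets of the unit interval of cardinality at most n is topologically Weihrauch reducible to convex choice in dimension n−1; that is, C_{[0,1],#≤n} ≤_W XC_{n−1}. -/

import Mathlib

/-! Framework: represented spaces, realizers, (strong) topological Weihrauch reducibility. -/

/-- Baire space ℕ^ℕ (with the product topology). -/
abbrev Baire : Type := ℕ → ℕ

/-- A standard pairing ⟨p, q⟩ on Baire space (interleaving). -/
def pairB (p q : Baire) : Baire := fun n => if n % 2 = 0 then p (n / 2) else q (n / 2)

/-- A representation of `X`: the name relation of a partial map from Baire space to `X`
(`R p x` means that `p` is a name of `x`). -/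
structure RepSp (X : Type*) where
  R : Baire → X → Prop

/-- Restriction of a representation to names in `A` (used for restrictions `f_A`). -/
def RepSp.restrict {X : Type*} (δ : RepSp X) (A : Set Baire) : RepSp X :=
  ⟨fun p x => δ.R p x ∧ p ∈ A⟩

/-- `F` is a realizer of the multivalued function `f` (whose domain is
`{x | (f x).Nonempty}`) with respect to the given representations. -/
def Realizes {X Y : Type*} (δX : RepSp X) (δY : RepSp Y) (f : X → Set Y)
    (F : Baire → Baire) : Prop :=
  ∀ p x, δX.R p x → (f x).Nonempty → ∃ y ∈ f x, δY.R (F p) y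

/-- Topological Weihrauch reducibility `f ≤_W g`: there are continuous partial functions
`H` (pre-processor) and `K` (post-processor) on Baire space such that
`p ↦ K⟨p, G (H p)⟩` realizes `f` for every realizer `G` of `g`. -/
def WRed {X Y U V : Type*} (δX : RepSp X) (δY : RepSp Y) (δU : RepSp U) (δV : RepSp V)
    (f : X → Set Y) (g : U → Set V) : Prop :=
  ∃ (H K : Baire → Baire) (dH dK : Set Baire), ContinuousOn H dH ∧ ContinuousOn K dK ∧
    ∀ G : Baire → Baire, Realizes δU δV g G →
      ∀ p x, δX.R p x → (f x).Nonempty →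
        p ∈ dH ∧ pairB p (G (H p)) ∈ dK ∧
          ∃ y ∈ f x, δY.R (K (pairB p (G (H p)))) y

/-- Strong topological Weihrauch reducibility `f ≤_sW g`:
`K ∘ G ∘ H` realizes `f` for every realizer `G` of `g`. -/
def SWRed {X Y U V : Type*} (δX : RepSp X) (δY : RepSp Y) (δU : RepSp U) (δV : RepSp V)
    (f : X → Set Y) (g : U → Set V) : Prop :=
  ∃ (H K : Baire → Baire) (dH dK : Set Baire), ContinuousOn H dH ∧ ContinuousOn K dK ∧
    ∀ G : Baire → Baire, Realizes δU δV g G →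
      ∀ p x, δX.R p x → (f x).Nonempty →
        p ∈ dH ∧ G (H p) ∈ dK ∧ ∃ y ∈ f x, δY.R (K (G (H p))) y

/-! Negative representation of closed subsets of a separable metric space with a
fixed dense sequence, Cauchy representation of points, and choice principles. -/

/-- An enumeration of the nonnegative rationals (as reals): `n ↦ a/(b+1)` with `(a,b)` = unpair. -/
noncomputable def ratCode (n : ℕ) : ℝ := (n.unpair.1 : ℝ) / ((n.unpair.2 : ℝ) + 1)

/-- The rational open ball of `X` coded by `n` (center from the dense sequence `α`,
rational radius; radius `0` yields the empty ball, allowing padding). -/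
noncomputable def ballCode {X : Type*} [MetricSpace X] (α : ℕ → X) (n : ℕ) : Set X :=
  Metric.ball (α n.unpair.1) (ratCode n.unpair.2)

/-- The negative representation `ψ₋` of closed sets: a name `p` enumerates rational open
balls and denotes `X` minus their union. -/
noncomputable def psiMinus {X : Type*} [MetricSpace X] (α : ℕ → X) (p : Baire) : Set X :=
  {x | ∀ i, x ∉ ballCode α (p i)}

/-- The represented space `A(X)` of closed subsets of `X` (negative information). -/
noncomputable def closedRep {X : Type*} [MetricSpace X] (α : ℕ → X) : RepSp (Set X) :=
  ⟨fun p A => A = psiMinus α p⟩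

/-- The Cauchy representation of points of `X` (w.r.t. the dense sequence `α`). -/
noncomputable def pointRep {X : Type*} [MetricSpace X] (α : ℕ → X) : RepSp X :=
  ⟨fun p x => ∀ i, dist x (α (p i)) < (2:ℝ)⁻¹ ^ i⟩

/-- Closed choice restricted to a class `𝔄` of sets: the multivalued map `A ↦ A` with
domain the nonempty members of `𝔄`. -/
def choiceFn {X : Type*} (𝔄 : Set (Set X)) : Set X → Set X :=
  fun A => {x | A ∈ 𝔄 ∧ x ∈ A}

/-- The class of (finite) sets of cardinality exactly `n`. -/
def cardEqClass (X : Type*) (n : ℕ) : Set (Set X) := {A | A.Finite ∧ A.ncard = n}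

/-- The class of nonempty (finite) sets of cardinality at most `n`. -/
def cardLeClass (X : Type*) (n : ℕ) : Set (Set X) :=
  {A | A.Finite ∧ A.Nonempty ∧ A.ncard ≤ n}

/-- The unit cube `[0,1]^n` inside `ℝ^n`. -/
def unitCube (n : ℕ) : Set (Fin n → ℝ) := Set.univ.pi fun _ => Set.Icc (0:ℝ) 1

/-- The class of nonempty closed convex subsets of the unit cube `[0,1]^n`. -/
def convexClass (n : ℕ) : Set (Set (Fin n → ℝ)) :=
  {A | A.Nonempty ∧ IsClosed A ∧ Convex ℝ A ∧ A ⊆ unitCube n}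

/-! Discrete spaces, Cantor space, products, composition, fractals. -/

/-- Cantor space `{0,1}^ℕ`, with the standard (first-difference) metric, whose topology
is the product topology. -/
noncomputable instance : MetricSpace (ℕ → Bool) := PiNat.metricSpace

/-- Representation of closed subsets of the discrete space `Fin k`:
a name enumerates the complement (`0` codes "nothing", `m+1` codes `m`). -/
def finSetRep (k : ℕ) : RepSp (Set (Fin k)) :=
  ⟨fun p A => A = {m : Fin k | ∀ i, p i ≠ (m : ℕ) + 1}⟩

/-- Representation of points of the discrete space `Fin k`: `p` names `m` iff `p 0 = m`. -/
def finPointRep (k : ℕ) : RepSp (Fin k) := ⟨fun p m => p 0 = (m : ℕ)⟩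

/-- Representation of closed subsets of the discrete space `ℕ`:
a name enumerates the complement (`0` codes "nothing", `m+1` codes `m`). -/
def natSetRep : RepSp (Set ℕ) := ⟨fun p A => A = {m : ℕ | ∀ i, p i ≠ m + 1}⟩

/-- Representation of points of the discrete space `ℕ`: `p` names `m` iff `p 0 = m`. -/
def natPointRep : RepSp ℕ := ⟨fun p m => p 0 = m⟩

/-- The `i`-th component of a name of an `n`-tuple (interleaving `n` streams). -/
def projB (n : ℕ) (i : Fin n) (p : Baire) : Baire := fun k => p (k * n + i)

/-- Representation of `n`-tuples: a name codes `n` names, interleaved. -/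
def piRep {X : Type*} (n : ℕ) (δ : RepSp X) : RepSp (Fin n → X) :=
  ⟨fun p x => ∀ i, δ.R (projB n i p) (x i)⟩

/-- The `n`-fold parallel product `f^n` of a multivalued function. -/
def piFn {X Y : Type*} (n : ℕ) (f : X → Set Y) : (Fin n → X) → Set (Fin n → Y) :=
  fun x => {y | ∀ i, y i ∈ f (x i)}

/-- Composition `g ∘ h` of multivalued functions: defined on those `t ∈ dom h` with
`h t ⊆ dom g`, mapping `t` to `⋃ {g u | u ∈ h t}`. -/
def mcomp {T U V : Type*} (g : U → Set V) (h : T → Set U) : T → Set V :=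
  fun t => {v | (h t).Nonempty ∧ (∀ u ∈ h t, (g u).Nonempty) ∧ ∃ u ∈ h t, v ∈ g u}

/-- `f` is a fractal: there is a multivalued `g` on a represented space with nonempty
carrier such that for every clopen `A` of Baire space the restriction `g_A` of `g` to
inputs with names in `A` is Weihrauch equivalent to `f`, or to the nowhere defined
function `0` (i.e. `g_A` has empty domain). -/
def Fractal {X Y : Type*} (δX : RepSp X) (δY : RepSp Y) (f : X → Set Y) : Prop :=
  ∃ (Z W : Type) (δZ : RepSp Z) (δW : RepSp W) (g : Z → Set W), Nonempty Z ∧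
    ∀ A : Set Baire, IsClopen A →
      (WRed (δZ.restrict A) δW δX δY g f ∧ WRed δX δY (δZ.restrict A) δW f g)
      ∨ ¬ ∃ p z, δZ.R p z ∧ p ∈ A ∧ (g z).Nonempty

/-- `f` is a closed fractal: as `Fractal`, with the witnessing representation total. -/
def ClosedFractal {X Y : Type*} (δX : RepSp X) (δY : RepSp Y) (f : X → Set Y) : Prop :=
  ∃ (Z W : Type) (δZ : RepSp Z) (δW : RepSp W) (g : Z → Set W), Nonempty Z ∧
    (∀ p : Baire, ∃ z, δZ.R p z) ∧
    ∀ A : Set Baire, IsClopen A →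
      (WRed (δZ.restrict A) δW δX δY g f ∧ WRed δX δY (δZ.restrict A) δW f g)
      ∨ ¬ ∃ p z, δZ.R p z ∧ p ∈ A ∧ (g z).Nonempty

/-- `X_ε(𝔄)`: the closure (in Baire space) of the set of `ψ₋`-names of sets `A ∈ 𝔄` such
that for every `x ∈ X` some `B ∈ 𝔄` satisfies `B ⊆ A \ B(x, ε)`. -/
noncomputable def Xeps {X : Type*} [MetricSpace X] (α : ℕ → X) (𝔄 : Set (Set X))
    (ε : ℝ) : Set Baire :=
  closure {p | psiMinus α p ∈ 𝔄 ∧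
    ∀ x : X, ∃ B ∈ 𝔄, B ⊆ psiMinus α p \ Metric.ball x ε}

/-- The represented space `ℝ_>`: a name is a nonincreasing sequence of rationals
converging to `x` (approximation from above). -/
noncomputable def gtRep : RepSp ℝ :=
  ⟨fun p x => (∀ i, ((Denumerable.ofNat ℚ (p (i+1)) : ℚ) : ℝ) ≤ ((Denumerable.ofNat ℚ (p i) : ℚ) : ℝ)) ∧
    Filter.Tendsto (fun i => ((Denumerable.ofNat ℚ (p i) : ℚ) : ℝ)) Filter.atTop (nhds x)⟩

open Set Filter Topology Metric

/-! ### Continuity on Baire space -/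

theorem Baire.exists_cylinder_subset {U : Set Baire} (hU : IsOpen U) {p : Baire} (hp : p ∈ U) :
    ∃ m, PiNat.cylinder p m ⊆ U := by
  obtain ⟨_, ⟨x, m, rfl⟩, hpx, hxU⟩ :=
    (PiNat.isTopologicalBasis_cylinders fun _ : ℕ => ℕ).exists_subset_of_mem_open hp hU
  exact ⟨m, by rwa [PiNat.mem_cylinder_iff_eq.1 hpx]⟩

theorem Baire.cylinder_eq_of_mem {p q : Baire} {M m : ℕ} (hq : q ∈ PiNat.cylinder p M)
    (hm : m ≤ M) : PiNat.cylinder q m = PiNat.cylinder p m :=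
  PiNat.mem_cylinder_iff_eq.1 (PiNat.cylinder_anti p hm hq)

theorem Baire.exists_continuous_enumeration (W : ℕ → Set Baire) (hW : ∀ c, IsOpen (W c)) :
    ∃ H : Baire → Baire, Continuous H ∧ (∀ p i, H p i = 0 ∨ p ∈ W (H p i)) ∧
      ∀ p c, p ∈ W c → ∃ i, H p i = c := by
  classical
  refine ⟨fun p i => if PiNat.cylinder p i.unpair.1 ⊆ W i.unpair.2 then i.unpair.2 else 0,
    continuous_pi fun i => IsLocallyConstant.continuous ?_, fun p i => ?_, fun p c hp => ?_⟩
  · refine (IsLocallyConstant.iff_exists_open _).2 fun p =>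
      ⟨_, PiNat.isOpen_cylinder _ p i.unpair.1, PiNat.self_mem_cylinder _ _, fun q hq => ?_⟩
    simp only [PiNat.mem_cylinder_iff_eq.1 hq]
  · by_cases h : PiNat.cylinder p i.unpair.1 ⊆ W i.unpair.2
    · simp only [if_pos h]
      exact Or.inr (h (PiNat.self_mem_cylinder _ _))
    · simp [if_neg h]
  · obtain ⟨m, hm⟩ := Baire.exists_cylinder_subset (hW c) hp
    exact ⟨Nat.pair m c, by simp [hm]⟩

/-- A countable open cover of a subspace of Baire space has a continuous choice function. -/
theorem Baire.exists_continuous_selection {D : Set Baire} (O : ℕ → Set D)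
    (hO : ∀ k, IsOpen (O k)) (hcov : ∀ x, ∃ k, x ∈ O k) :
    ∃ f : D → ℕ, Continuous f ∧ ∀ x, x ∈ O (f x) := by
  classical
  choose U hU hUO using fun k => isOpen_induced_iff.1 (hO k)
  have hex : ∀ x : D, ∃ c : ℕ, PiNat.cylinder (x : Baire) c.unpair.1 ⊆ U c.unpair.2 := by
    intro x
    obtain ⟨k, hk⟩ := hcov x
    rw [← hUO k] at hk
    obtain ⟨m, hm⟩ := Baire.exists_cylinder_subset (hU k) hk
    exact ⟨Nat.pair m k, by simpa using hm⟩
  refine ⟨fun x => (Nat.find (hex x)).unpair.2, IsLocallyConstant.continuous ?_, fun x => ?_⟩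
  · refine (IsLocallyConstant.iff_exists_open _).2 fun x =>
      ⟨_, (PiNat.isOpen_cylinder _ (x : Baire) (Nat.find (hex x))).preimage
        continuous_subtype_val, PiNat.self_mem_cylinder _ _, fun y hy => ?_⟩
    have key : ∀ c ≤ Nat.find (hex x), PiNat.cylinder (y : Baire) c.unpair.1 =
        PiNat.cylinder (x : Baire) c.unpair.1 := fun c hc =>
      Baire.cylinder_eq_of_mem hy ((Nat.unpair_left_le c).trans hc)
    have hfind : Nat.find (hex y) = Nat.find (hex x) := by
      refine (Nat.find_eq_iff _).2 ⟨?_, fun c hc => ?_⟩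
      · rw [key _ le_rfl]
        exact Nat.find_spec (hex x)
      · rw [key _ hc.le]
        exact Nat.find_min (hex x) hc
    simp only [hfind]
  · rw [← hUO]
    exact Nat.find_spec (hex x) (PiNat.self_mem_cylinder _ _)

/-- Dependent version of `Baire.exists_continuous_selection`: continuous choice of a branch. -/
theorem Baire.exists_continuous_branch {D : Set Baire} (S : ℕ → ℕ → Set D)
    (R : ℕ → ℕ → ℕ → Prop) (hS : ∀ i k, IsOpen (S i k)) (h0 : ∀ x, ∃ k, x ∈ S 0 k)
    (hstep : ∀ i k, ∀ x ∈ S i k, ∃ k', R i k k' ∧ x ∈ S (i + 1) k') :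
    ∃ g : D → Baire, Continuous g ∧ (∀ x i, x ∈ S i (g x i)) ∧
      ∀ x i, R i (g x i) (g x (i + 1)) := by
  obtain ⟨f0, hf0, hf0S⟩ := Baire.exists_continuous_selection (S 0) (hS 0) h0
  have next : ∀ (i : ℕ) (f : {f : D → ℕ // Continuous f ∧ ∀ x, x ∈ S i (f x)}),
      ∃ f' : {f' : D → ℕ // Continuous f' ∧ ∀ x, x ∈ S (i + 1) (f' x)},
        ∀ x, R i (f.1 x) (f'.1 x) := by
    rintro i ⟨f, hf, hfS⟩
    obtain ⟨f', hf', hf'S⟩ := Baire.exists_continuous_selection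
      (fun k' => S (i + 1) k' ∩ f ⁻¹' {k | R i k k'})
      (fun k' => (hS _ _).inter ((isOpen_discrete _).preimage hf))
      (fun x => by
        obtain ⟨k', h1, h2⟩ := hstep i _ x (hfS x)
        exact ⟨k', h2, h1⟩)
    exact ⟨⟨f', hf', fun x => (hf'S x).1⟩, fun x => (hf'S x).2⟩
  choose nx hnx using next
  let F : ∀ i : ℕ, {f : D → ℕ // Continuous f ∧ ∀ x, x ∈ S i (f x)} := fun i =>
    Nat.rec ⟨f0, hf0, hf0S⟩ (fun i f => nx i f) i
  exact ⟨fun x i => (F i).1 x, continuous_pi fun i => (F i).2.1, fun x i => (F i).2.2 x,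
    fun x i => hnx i (F i) x⟩

/-! ### Negative information about compact sets -/

section Negative

variable {X : Type*} [MetricSpace X]

theorem isOpen_ballCode (α : ℕ → X) (c : ℕ) : IsOpen (ballCode α c) := isOpen_ball

theorem ballCode_zero (α : ℕ → X) : ballCode α 0 = ∅ := by
  simp [ballCode, ratCode]

theorem isClosed_psiMinus (α : ℕ → X) (p : Baire) : IsClosed (psiMinus α p) := by
  have : psiMinus α p = ⋂ i, (ballCode α (p i))ᶜ := by
    ext x
    simp [psiMinus]
  rw [this]
  exact isClosed_iInter fun i => (isOpen_ballCode α _).isClosed_compl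

theorem isOpen_setOf_disjoint_psiMinus (α : ℕ → X) {F : Set X} (hF : IsCompact F) :
    IsOpen {p : Baire | Disjoint F (psiMinus α p)} := by
  rw [isOpen_iff_mem_nhds]
  intro p hp
  obtain ⟨t, ht⟩ := hF.elim_finite_subcover (fun i => ballCode α (p i))
    (fun i => isOpen_ballCode α _) (fun x hx => by
      have := Set.disjoint_left.1 hp hx
      simpa [psiMinus] using this)
  have hev : ∀ᶠ q : Baire in 𝓝 p, ∀ i ∈ t, q i = p i :=
    (eventually_all_finset t).2 fun i _ =>
      ((isOpen_discrete {p i}).preimage (continuous_apply i)).mem_nhds (Set.mem_singleton _)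
  filter_upwards [hev] with q hq
  refine Set.disjoint_left.2 fun x hx hxq => ?_
  obtain ⟨i, hi, hxi⟩ := by simpa using ht hx
  exact hxq i (by rwa [hq i hi])

theorem isOpen_setOf_image_subset [CompactSpace X] {E : Type*} [TopologicalSpace E] (α : ℕ → X)
    {v : X → E} (hv : Continuous v) {B : Set X} (hB : IsOpen B) {U : Set E} (hU : IsOpen U) :
    IsOpen {p : Baire | v '' (psiMinus α p \ B) ⊆ U} := by
  have hF : IsCompact (Bᶜ ∩ (v ⁻¹' U)ᶜ) :=
    (hB.isClosed_compl.inter (hU.preimage hv).isClosed_compl).isCompact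
  convert isOpen_setOf_disjoint_psiMinus α hF using 3 with p
  rw [Set.disjoint_left, Set.image_subset_iff]
  constructor
  · exact fun h x hx hxp => hx.2 (h ⟨hxp, hx.1⟩)
  · exact fun h x hx => by_contra fun hxU => h ⟨hx.2, hxU⟩ hx.1

theorem exists_mem_ballCode_subset {β : ℕ → X} (hβ : DenseRange β) (y : X) {ε : ℝ} (hε : 0 < ε) :
    ∃ c, y ∈ ballCode β c ∧ ballCode β c ⊆ ball y ε := by
  obtain ⟨b, hb⟩ := exists_nat_one_div_lt (half_pos hε)
  obtain ⟨j, hj⟩ := hβ.exists_dist_lt y (Nat.one_div_pos_of_nat (α := ℝ) (n := b))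
  have hc : ballCode β (Nat.pair j (Nat.pair 1 b)) = ball (β j) (1 / ((b : ℝ) + 1)) := by
    simp [ballCode, ratCode]
  refine ⟨Nat.pair j (Nat.pair 1 b), ?_, ?_⟩ <;> rw [hc]
  · exact hj
  · refine ball_subset_ball' ?_
    rw [dist_comm]
    linarith

end Negative

theorem exists_disjoint_thickening_ball {E : Type*} [PseudoMetricSpace E] {C : Set E}
    (hC : IsClosed C) {y : E} (hy : y ∉ C) :
    ∃ ε > 0, Disjoint (thickening ε C) (ball y ε) := by
  obtain ⟨ε, hε, h⟩ := (Set.disjoint_singleton_left.2 hy).exists_thickenings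
    isCompact_singleton hC
  rw [thickening_singleton] at h
  exact ⟨ε, hε, h.symm⟩

/-- A name of the convex hull of the image of a finite set can be computed continuously. -/
theorem exists_continuous_name_convexHull {X E : Type*} [MetricSpace X] [CompactSpace X]
    [NormedAddCommGroup E] [NormedSpace ℝ E] (α : ℕ → X) {β : ℕ → E} (hβ : DenseRange β)
    {v : X → E} (hv : Continuous v) :
    ∃ H : Baire → Baire, Continuous H ∧ ∀ p, (psiMinus α p).Finite →
      psiMinus β (H p) = convexHull ℝ (v '' psiMinus α p) := by
  obtain ⟨H, hH, hsound, hcompl⟩ := Baire.exists_continuous_enumeration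
    (fun c => interior {p | Disjoint (ballCode β c) (convexHull ℝ (v '' psiMinus α p))})
    (fun c => isOpen_interior)
  refine ⟨H, hH, fun p hfin => Set.Subset.antisymm (fun y hy => ?_) fun y hy i hyi => ?_⟩
  · by_contra hyC
    obtain ⟨ε, hε, hdis⟩ := exists_disjoint_thickening_ball
      ((hfin.image v).isClosed_convexHull ℝ) hyC
    obtain ⟨c, hyc, hcε⟩ := exists_mem_ballCode_subset hβ y hε
    have hpc : p ∈ interior
        {p | Disjoint (ballCode β c) (convexHull ℝ (v '' psiMinus α p))} := by
      refine mem_interior.2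
        ⟨{q | v '' (psiMinus α q \ ∅) ⊆ thickening ε (convexHull ℝ (v '' psiMinus α p))},
          fun q hq => ?_, isOpen_setOf_image_subset α hv isOpen_empty isOpen_thickening, ?_⟩
      · rw [Set.mem_ofPred_eq, Set.sdiff_empty] at hq
        exact hdis.symm.mono hcε (convexHull_min hq ((convex_convexHull ℝ _).thickening ε))
      · rw [Set.mem_ofPred_eq, Set.sdiff_empty]
        exact (subset_convexHull ℝ _).trans (self_subset_thickening hε _)
    obtain ⟨i, hi⟩ := hcompl p c hpc
    exact hy i (hi ▸ hyc)
  · rcases hsound p i with h | h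
    · rw [h, ballCode_zero] at hyi
      exact hyi
    · exact Set.disjoint_left.1 (interior_subset h) hyi hy

/-! ### Essential vertices of a simplex -/

theorem mem_convexHull_sdiff_of_forall_mem_erase {E : Type*} [AddCommGroup E] [Module ℝ E]
    [DecidableEq E] {T : Finset E} (hT : AffineIndependent ℝ ((↑) : T → E)) {y : E}
    (hy : y ∈ convexHull ℝ (T : Set E)) (R : Finset E)
    (hR : ∀ a ∈ R, y ∈ convexHull ℝ ((T.erase a : Finset E) : Set E)) :
    y ∈ convexHull ℝ ((T \ R : Finset E) : Set E) := by
  induction R using Finset.induction_on with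
  | empty => simpa using hy
  | insert a R _ ih =>
    have h1 := ih fun b hb => hR b (Finset.mem_insert_of_mem hb)
    have h2 := hR a (Finset.mem_insert_self a R)
    have h3 := hT.convexHull_inter (T.erase_subset a) (Finset.sdiff_subset (s := T) (t := R))
    have h4 : T \ insert a R = T.erase a ∩ (T \ R) := by
      ext z
      simp only [Finset.mem_sdiff, Finset.mem_insert, Finset.mem_inter, Finset.mem_erase]
      tauto
    rw [h4, Finset.coe_inter, h3]
    exact ⟨h2, h1⟩

theorem exists_essential_vertex {X E : Type*} [AddCommGroup E] [Module ℝ E] {v : X → E}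
    (hv : Function.Injective v) {A : Set X} (hA : A.Finite)
    (hind : AffineIndependent ℝ fun x : A => v x) {y : E} (hy : y ∈ convexHull ℝ (v '' A))
    {B : Set X} (hB : y ∉ convexHull ℝ (v '' (A \ B))) :
    ∃ a ∈ B, ∀ B' : Set X, a ∈ B' → y ∉ convexHull ℝ (v '' (A \ B')) := by
  classical
  by_contra! hcon
  have hT : ((hA.image v).toFinset : Set E) = v '' A := by simp
  have hind' : AffineIndependent ℝ ((↑) : (hA.image v).toFinset → E) := by
    have h := hind.range
    have hr : Set.range (fun x : A => v x) = ((hA.image v).toFinset : Set E) := by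
      rw [hT]
      ext
      simp
    rw [hr] at h
    exact h
  refine hB ?_
  have key := mem_convexHull_sdiff_of_forall_mem_erase hind' (by rwa [hT])
    ((hA.image v).toFinset.filter (· ∈ v '' B)) (y := y) ?_
  · refine convexHull_mono ?_ key
    intro z hz
    rw [Set.image_sdiff hv]
    simp only [Finset.coe_sdiff, Finset.coe_filter, Set.mem_sdiff, hT, Set.mem_ofPred_eq,
      Set.Finite.mem_toFinset] at hz
    exact ⟨hz.1, fun h => hz.2 ⟨hz.1, h⟩⟩
  · intro b hb
    obtain ⟨a, haB, rfl⟩ := (Finset.mem_filter.1 hb).2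
    obtain ⟨B', haB', hyB'⟩ := hcon a haB
    refine convexHull_mono ?_ hyB'
    rw [Finset.coe_erase, hT, Set.image_sdiff hv]
    exact fun z hz => ⟨hz.1, fun h => hz.2 ⟨a, haB', (Set.mem_singleton_iff.1 h).symm⟩⟩

/-! ### The moment curve -/

/-- The moment curve `t ↦ (t, t², …, tᵐ)` on the unit interval. -/
def momentCurve (m : ℕ) (t : Set.Icc (0 : ℝ) 1) : Fin m → ℝ := fun i => (t : ℝ) ^ ((i : ℕ) + 1)

theorem continuous_momentCurve (m : ℕ) : Continuous (momentCurve m) :=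
  continuous_pi fun _ => continuous_subtype_val.pow _

theorem momentCurve_injective {m : ℕ} (hm : 0 < m) : Function.Injective (momentCurve m) := by
  intro s t h
  have := congrFun h ⟨0, hm⟩
  simpa [momentCurve, Subtype.ext_iff] using this

theorem momentCurve_mem_unitCube (m : ℕ) (t : Set.Icc (0 : ℝ) 1) :
    momentCurve m t ∈ unitCube m :=
  fun _ _ => ⟨pow_nonneg t.2.1 _, pow_le_one₀ t.2.1 t.2.2⟩

theorem affineIndependent_momentCurve {m : ℕ} {A : Set (Set.Icc (0 : ℝ) 1)} (hA : A.Finite)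
    (hcard : A.ncard ≤ m + 1) : AffineIndependent ℝ fun x : A => momentCurve m x := by
  classical
  rw [affineIndependent_iff]
  intro s w hw hwv
  have hmom : ∀ k < m + 1, ∑ e ∈ s, w e * ((e : Set.Icc (0 : ℝ) 1) : ℝ) ^ k = 0 := by
    rintro (_ | k) hk
    · simpa using hw
    · simpa [momentCurve] using congrFun hwv ⟨k, by omega⟩
  have hpoly : ∀ P : Polynomial ℝ, P.natDegree < m + 1 →
      ∑ e ∈ s, w e * P.eval ((e : Set.Icc (0 : ℝ) 1) : ℝ) = 0 := by
    intro P hP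
    simp_rw [Polynomial.eval_eq_sum_range' hP, Finset.mul_sum]
    rw [Finset.sum_comm]
    refine Finset.sum_eq_zero fun k hk => ?_
    have := hmom k (Finset.mem_range.1 hk)
    calc ∑ e ∈ s, w e * (P.coeff k * ((e : Set.Icc (0 : ℝ) 1) : ℝ) ^ k)
        = P.coeff k * ∑ e ∈ s, w e * ((e : Set.Icc (0 : ℝ) 1) : ℝ) ^ k := by
          rw [Finset.mul_sum]
          exact Finset.sum_congr rfl fun _ _ => by ring
      _ = 0 := by rw [this, mul_zero]
  have hs : s.card ≤ m + 1 := by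
    have := hA.to_subtype
    calc s.card ≤ Nat.card A := by
          have := Fintype.ofFinite A
          rw [Nat.card_eq_fintype_card]
          exact s.card_le_univ
      _ ≤ m + 1 := hcard
  intro e he
  let P : Polynomial ℝ := ∏ z ∈ s.erase e, (Polynomial.X - Polynomial.C ((z : Set.Icc (0 : ℝ) 1) : ℝ))
  have hdeg : P.natDegree < m + 1 := by
    rw [Polynomial.natDegree_finsetProd_X_sub_C_eq_card, Finset.card_erase_of_mem he]
    have := Finset.card_pos.2 ⟨e, he⟩
    omega
  have h := hpoly P hdeg
  rw [Finset.sum_eq_single_of_mem e he ?_] at h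
  · refine (mul_eq_zero.1 h).resolve_right ?_
    rw [Polynomial.eval_prod, ← ne_eq, Finset.prod_ne_zero_iff]
    intro z hz
    simp only [Polynomial.eval_sub, Polynomial.eval_X, Polynomial.eval_C, ne_eq, sub_eq_zero]
    exact fun h => (Finset.mem_erase.1 hz).1 (Subtype.ext (Subtype.ext h)).symm
  · intro z hz hze
    rw [Polynomial.eval_prod, Finset.prod_eq_zero (Finset.mem_erase.2 ⟨hze, hz⟩) (by simp),
      mul_zero]

/-! ### Recovering a vertex from a point of the simplex -/

section Decode

variable {X E : Type*} [MetricSpace X] [NormedAddCommGroup E] [NormedSpace ℝ E]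

/-- The even-indexed half of a point of Baire space. -/
def fstB (r : Baire) : Baire := fun i => r (2 * i)

/-- The odd-indexed half of a point of Baire space. -/
def sndB (r : Baire) : Baire := fun i => r (2 * i + 1)

theorem fstB_pairB (p q : Baire) : fstB (pairB p q) = p := by
  funext i
  simp [fstB, pairB]

theorem sndB_pairB (p q : Baire) : sndB (pairB p q) = q := by
  funext i
  have h : (2 * i + 1) / 2 = i := by omega
  have h' : (2 * i + 1) % 2 = 1 := by omega
  simp [sndB, pairB, h, h']

theorem continuous_fstB : Continuous fstB := continuous_pi fun _ => continuous_apply _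

theorem continuous_sndB : Continuous sndB := continuous_pi fun _ => continuous_apply _

/-- Pairs of a negative name of a finite set `A` such that `v` is affinely independent on `A`,
and a Cauchy name of a point in the convex hull of `v '' A`. -/
def simplexPointNames (α : ℕ → X) (β : ℕ → E) (v : X → E) : Set Baire :=
  {r | (psiMinus α (fstB r)).Finite ∧
    (AffineIndependent ℝ fun x : psiMinus α (fstB r) => v x) ∧
    ∃ y ∈ convexHull ℝ (v '' psiMinus α (fstB r)), (pointRep β).R (sndB r) y}

theorem isOpen_setOf_notMem_convexHull [CompactSpace X] (α : ℕ → X) (β : ℕ → E) {v : X → E}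
    (hv : Continuous v) (Y : simplexPointNames α β v → E)
    (hY : ∀ r : simplexPointNames α β v, (pointRep β).R (sndB r) (Y r)) {B : Set X} (hB : IsOpen B) :
    IsOpen {r : simplexPointNames α β v |
      Y r ∉ convexHull ℝ (v '' (psiMinus α (fstB r) \ B))} := by
  rw [isOpen_iff_mem_nhds]
  intro r hr
  obtain ⟨ε, hε, hdis⟩ := exists_disjoint_thickening_ball
    (((r.2.1.sdiff (t := B)).image v).isClosed_convexHull ℝ) hr
  obtain ⟨i, hi⟩ := exists_pow_lt_of_lt_one (half_pos hε) (by norm_num : (2 : ℝ)⁻¹ < 1)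
  have h1 : ∀ᶠ r' : simplexPointNames α β v in 𝓝 r,
      v '' (psiMinus α (fstB r') \ B) ⊆
        thickening ε (convexHull ℝ (v '' (psiMinus α (fstB r) \ B))) :=
    ((isOpen_setOf_image_subset α hv hB isOpen_thickening).preimage
      (continuous_fstB.comp continuous_subtype_val)).mem_nhds
      ((subset_convexHull ℝ _).trans (self_subset_thickening hε _))
  have h2 : ∀ᶠ r' : simplexPointNames α β v in 𝓝 r, sndB r' i = sndB r i :=
    ((isOpen_discrete {sndB r i}).preimage
      (((continuous_apply i).comp continuous_sndB).comp continuous_subtype_val)).mem_nhds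
      (Set.mem_singleton _)
  filter_upwards [h1, h2] with r' hr1 hr2 hmem
  refine Set.disjoint_left.1 hdis
    (convexHull_min hr1 ((convex_convexHull ℝ _).thickening ε) hmem) ?_
  have ha := hY r i
  have hb := hY r' i
  rw [hr2] at hb
  rw [mem_ball]
  have := dist_triangle_right (Y r') (Y r) (β (sndB r i))
  linarith

theorem exists_continuous_vertex [CompactSpace X] {α : ℕ → X}
    (hα : DenseRange α) (β : ℕ → E) {v : X → E} (hv : Continuous v)
    (hinj : Function.Injective v) :
    ∃ K : Baire → Baire, ContinuousOn K (simplexPointNames α β v) ∧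
      ∀ r ∈ simplexPointNames α β v, ∃ x ∈ psiMinus α (fstB r), (pointRep α).R (K r) x := by
  classical
  choose Y hYmem hY using fun r : simplexPointNames α β v => r.2.2.2
  have hrad : ∀ i : ℕ, (0 : ℝ) < 1 / 4 / 2 ^ i := fun i => by positivity
  obtain ⟨g, hg, hgS, hgR⟩ := Baire.exists_continuous_branch
    (fun i k => {r : simplexPointNames α β v |
      Y r ∉ convexHull ℝ (v '' (psiMinus α (fstB r) \ ball (α k) (1 / 4 / 2 ^ i)))})
    (fun i k k' => dist (α k) (α k') ≤ 3 / 4 / 2 / 2 ^ i)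
    (fun i k => isOpen_setOf_notMem_convexHull α β hv Y hY isOpen_ball)
    (fun r => by
      obtain ⟨a, -, ha⟩ := exists_essential_vertex hinj r.2.1 r.2.2.1 (hYmem r)
        (B := Set.univ) (by simp)
      obtain ⟨k, hk⟩ := hα.exists_dist_lt a (hrad 0)
      exact ⟨k, ha _ hk⟩)
    (fun i k r hr => by
      obtain ⟨a, haB, ha⟩ := exists_essential_vertex hinj r.2.1 r.2.2.1 (hYmem r) hr
      obtain ⟨k', hk'⟩ := hα.exists_dist_lt a (hrad (i + 1))
      refine ⟨k', ?_, ha _ hk'⟩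
      have h1 := dist_triangle_left (α k) (α k') a
      have h2 : dist a (α k) < 1 / 4 / 2 ^ i := haB
      have h3 : (1 : ℝ) / 4 / 2 ^ (i + 1) = 1 / 4 / 2 ^ i / 2 := by
        rw [pow_succ]
        field_simp
      have h4 : (3 : ℝ) / 4 / 2 / 2 ^ i = 1 / 4 / 2 ^ i * (3 / 2) := by ring
      linarith)
  refine ⟨fun r => if h : r ∈ simplexPointNames α β v then g ⟨r, h⟩ else 0, ?_, fun r hr => ?_⟩
  · rw [continuousOn_iff_continuous_domRestrict]
    convert hg using 1
    funext r
    simp [Set.domRestrict]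
  · simp only [dif_pos hr]
    obtain ⟨x, hx⟩ := cauchySeq_tendsto_of_complete
      (cauchySeq_of_le_geometric_two (hgR ⟨r, hr⟩))
    have hdist := dist_le_of_le_geometric_two_of_tendsto (hgR ⟨r, hr⟩) hx
    refine ⟨x, ?_, fun i => ?_⟩
    · have hex : ∀ i, ∃ a ∈ psiMinus α (fstB r), dist a (α (g ⟨r, hr⟩ i)) < 1 / 4 / 2 ^ i := by
        intro i
        by_contra! hcon
        refine hgS ⟨r, hr⟩ i ?_
        have : psiMinus α (fstB r) \ ball (α (g ⟨r, hr⟩ i)) (1 / 4 / 2 ^ i) =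
            psiMinus α (fstB r) :=
          sdiff_eq_left.2 (Set.disjoint_left.2 fun a ha hab =>
            absurd (mem_ball.1 hab) (not_lt.2 (hcon a ha)))
        rw [this]
        exact hYmem ⟨r, hr⟩
      rw [← (isClosed_psiMinus α (fstB r)).closure_eq, Metric.mem_closure_iff]
      intro ε hε
      obtain ⟨i, hi⟩ := exists_pow_lt_of_lt_one hε (by norm_num : (2 : ℝ)⁻¹ < 1)
      obtain ⟨a, haA, ha⟩ := hex i
      refine ⟨a, haA, ?_⟩
      have h1 := hdist i
      have h2 := dist_triangle_left x a (α (g ⟨r, hr⟩ i))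
      rw [dist_comm (α _) a] at h2
      have h3 : (1 : ℝ) / 4 / 2 ^ i + 3 / 4 / 2 ^ i = 2⁻¹ ^ i := by
        rw [inv_pow]
        ring
      linarith
    · rw [dist_comm]
      refine (hdist i).trans_lt ?_
      rw [inv_pow, div_eq_mul_inv]
      have : (0 : ℝ) < (2 ^ i)⁻¹ := by positivity
      linarith

end Decode

/-- For every n ≥ 2, C_{[0,1],#≤n} ≤_W XC_{n−1}. -/
theorem stmt1 (n : ℕ) (hn : 2 ≤ n)
    (α : ℕ → ↥(Set.Icc (0:ℝ) 1)) (hα : DenseRange α)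
    (β : ℕ → (Fin (n - 1) → ℝ)) (hβ : DenseRange β) :
    WRed (closedRep α) (pointRep α) (closedRep β) (pointRep β)
        (choiceFn (cardLeClass ↥(Set.Icc (0:ℝ) 1) n))
        (choiceFn (convexClass (n - 1))) := by
  have hv := continuous_momentCurve (n - 1)
  obtain ⟨H, hH, hHname⟩ := exists_continuous_name_convexHull α hβ hv
  obtain ⟨K, hK, hKvertex⟩ := exists_continuous_vertex hα β hv
    (momentCurve_injective (by omega))
  refine ⟨H, K, Set.univ, _, hH.continuousOn, hK, ?_⟩
  rintro G hG p A rfl ⟨a, hA, -⟩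
  obtain ⟨hfin, hne, hcard⟩ := hA
  have hCmem : convexHull ℝ (momentCurve (n - 1) '' psiMinus α p) ∈ convexClass (n - 1) :=
    ⟨(hne.image _).convexHull, (hfin.image _).isClosed_convexHull ℝ, convex_convexHull ℝ _,
      convexHull_min (Set.image_subset_iff.2 fun t _ => momentCurve_mem_unitCube _ t)
        (convex_pi fun _ _ => convex_Icc 0 1)⟩
  obtain ⟨z, hz⟩ := hCmem.1
  obtain ⟨y, ⟨-, hy⟩, hyG⟩ := hG (H p) _ (hHname p hfin).symm ⟨z, hCmem, hz⟩
  have hr : pairB p (G (H p)) ∈ simplexPointNames α β (momentCurve (n - 1)) := by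
    rw [simplexPointNames, Set.mem_ofPred_eq, fstB_pairB, sndB_pairB]
    exact ⟨hfin, affineIndependent_momentCurve hfin (by omega), y, hy, hyG⟩
  obtain ⟨x, hx, hxK⟩ := hKvertex _ hr
  rw [fstB_pairB] at hx
  exact ⟨Set.mem_univ _, hr, x, ⟨⟨hfin, hne, hcard⟩, hx⟩, hxK⟩
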